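/- Let Γ be a geometric distance-regular graph with classical parameters (D, b, α, β) such that b ≥ 2, 1 ≤ α ≤ b−1 and D ≥ 3, with line set 𝓒 (a set of Delsarte cliques such that every edge lies in a unique member), and let r = [D]. If β > (r − α − 1)αb + α, then Γ satisfies the dual Pasch axiom: for every pair of adjacent vertices x, y, the set of common neighbours of x and y that lie outside the unique line through x and y is a clique. -/

import Mathlib

open SimpleGraph

namespace DRGPaper

variable {V : Type*}

/-- `Γ` is a distance-regular graph with diameter `D` and intersection arrays `cc`, `aa`, `bb`:
`Γ` is connected of diameter `D` and for any vertices `x, y` at distance `i ≤ D`, `y` has exactly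
`cc i` neighbours at distance `i - 1` from `x`, `aa i` neighbours at distance `i` from `x`,
and `bb i` neighbours at distance `i + 1` from `x`. -/
def IsDRG [Fintype V] (G : SimpleGraph V) (D : ℕ) (cc aa bb : ℕ → ℕ) : Prop :=
  G.Connected ∧
  (∀ x y : V, G.dist x y ≤ D) ∧
  (∃ x y : V, G.dist x y = D) ∧
  ∀ i : ℕ, i ≤ D → ∀ x y : V, G.dist x y = i →
    {z : V | G.Adj y z ∧ G.dist x z = i - 1}.ncard = cc i ∧
    {z : V | G.Adj y z ∧ G.dist x z = i}.ncard = aa i ∧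
    {z : V | G.Adj y z ∧ G.dist x z = i + 1}.ncard = bb i

/-- `[j] = (b^j - 1)/(b - 1) = 1 + b + ⋯ + b^(j-1)` as a real number. -/
def gauss (b j : ℕ) : ℝ := ∑ i ∈ Finset.range j, (b : ℝ) ^ i

/-- `Γ` has classical parameters `(D, b, α, β)`: it is distance-regular of diameter `D` with
`bb i = ([D] - [i])(β - α[i])` for `0 ≤ i ≤ D - 1` and `cc i = [i](1 + α[i-1])` for
`1 ≤ i ≤ D`. -/
def HasClassicalParams [Fintype V] (G : SimpleGraph V) (D b : ℕ) (α β : ℝ)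
    (cc aa bb : ℕ → ℕ) : Prop :=
  IsDRG G D cc aa bb ∧
  (∀ i : ℕ, i ≤ D - 1 → (bb i : ℝ) = (gauss b D - gauss b i) * (β - α * gauss b i)) ∧
  (∀ i : ℕ, 1 ≤ i → i ≤ D → (cc i : ℝ) = gauss b i * (1 + α * gauss b (i - 1)))

/-- `d(x, C) = min {d(x, y) : y ∈ C}`. -/
noncomputable def distToSet (G : SimpleGraph V) (x : V) (C : Set V) : ℕ :=
  sInf (G.dist x '' C)

/-- A maximal clique of `G`. -/
def IsMaxClique (G : SimpleGraph V) (s : Set V) : Prop :=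
  G.IsClique s ∧ ∀ t : Set V, G.IsClique t → s ⊆ t → t = s

/-- The lines for the PLS(γ) property: maximal cliques with at least `γ` vertices. -/
def plsLines (G : SimpleGraph V) (γ : ℕ) : Set (Set V) :=
  {ℓ : Set V | IsMaxClique G ℓ ∧ γ ≤ ℓ.ncard}

/-- `G` is the point graph of the partial linear space with line set `L`: any two adjacent
vertices lie on exactly one common line of `L`. -/
def IsPointGraphOf (G : SimpleGraph V) (L : Set (Set V)) : Prop :=
  ∀ x y : V, G.Adj x y → ∃! ℓ : Set V, ℓ ∈ L ∧ x ∈ ℓ ∧ y ∈ ℓ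

/-- A vertex is a Delsarte vertex (w.r.t. the line set `L` and classical parameter `β`) if all
lines through it have exactly `β + 1` vertices. -/
def IsDelsarteVertex (L : Set (Set V)) (β : ℝ) (x : V) : Prop :=
  ∀ ℓ ∈ L, x ∈ ℓ → (ℓ.ncard : ℝ) = β + 1

/-- The lines for the SPLS(c, s) property: maximal cliques with at least
`a1 + 2 - (c - 1)(s - 1)` vertices. -/
def splsLines (G : SimpleGraph V) (a1 c s : ℕ) : Set (Set V) :=
  {ℓ : Set V | IsMaxClique G ℓ ∧ (a1 : ℤ) + 2 - ((c : ℤ) - 1) * ((s : ℤ) - 1) ≤ (ℓ.ncard : ℤ)}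

/-- The SPLS(c, s) property: `G` is the point graph of the partial linear space whose lines are
the maximal cliques with at least `a1 + 2 - (c-1)(s-1)` vertices, `a1 ≥ (2s-1)(c-1)`, each
vertex lies on at most `s` lines, and every point not on a line `ℓ` is collinear with at most
`c` points of `ℓ`.  SPLS(s) is the case `c = c₂`. -/
def HasSPLS (G : SimpleGraph V) (a1 c s : ℕ) : Prop :=
  1 ≤ c ∧ 2 ≤ s ∧
  (2 * (s : ℤ) - 1) * ((c : ℤ) - 1) ≤ (a1 : ℤ) ∧
  IsPointGraphOf G (splsLines G a1 c s) ∧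
  (∀ x : V, {ℓ ∈ splsLines G a1 c s | x ∈ ℓ}.ncard ≤ s) ∧
  (∀ ℓ ∈ splsLines G a1 c s, ∀ x : V, x ∉ ℓ → {y ∈ ℓ | G.Adj x y}.ncard ≤ c)

/-- `[x, y]`: the set of lines `ℓ ∈ L` through `x` such that `d(y, u) ≤ 2` for all `u ∈ ℓ`. -/
def lineXY (G : SimpleGraph V) (L : Set (Set V)) (x y : V) : Set (Set V) :=
  {ℓ ∈ L | x ∈ ℓ ∧ ∀ u ∈ ℓ, G.dist y u ≤ 2}

/-- `𝓒` witnesses that `G` is geometric with cliques of order `q`: every member of `𝓒` is a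
clique with exactly `q` vertices and every edge of `G` lies in a unique member of `𝓒`. -/
def IsGeomLineSet (G : SimpleGraph V) (q : ℝ) (𝓒 : Set (Set V)) : Prop :=
  (∀ C ∈ 𝓒, G.IsClique C ∧ (C.ncard : ℝ) = q) ∧
  ∀ x y : V, G.Adj x y → ∃! C : Set V, C ∈ 𝓒 ∧ x ∈ C ∧ y ∈ C

/-- `G` is geometric: there is a set of Delsarte cliques (cliques of the maximum order `q`)
such that every edge lies in a unique member. -/
def IsGeometric (G : SimpleGraph V) (q : ℝ) : Prop :=
  ∃ 𝓒 : Set (Set V), IsGeomLineSet G q 𝓒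

/-- An assembly: a maximal clique which is not a line. -/
def IsAssembly (G : SimpleGraph V) (𝓒 : Set (Set V)) (M : Set V) : Prop :=
  IsMaxClique G M ∧ M ∉ 𝓒

/-- The dual Pasch axiom: for every pair of adjacent vertices `x, y`, the common neighbours of
`x` and `y` outside the (any) line of `𝓒` through `x` and `y` form a clique. -/
def DualPasch (G : SimpleGraph V) (𝓒 : Set (Set V)) : Prop :=
  ∀ x y : V, G.Adj x y → ∀ ℓ ∈ 𝓒, x ∈ ℓ → y ∈ ℓ →
    G.IsClique {z : V | G.Adj x z ∧ G.Adj y z ∧ z ∉ ℓ}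

/-- The `m × n` grid, i.e. the Cartesian product `K_m □ K_n`. -/
def gridGraph (m n : ℕ) : SimpleGraph (Fin m × Fin n) :=
  (⊤ : SimpleGraph (Fin m)).boxProd (⊤ : SimpleGraph (Fin n))

/-- The `A`-clique extension of a graph `H`: replace every vertex of `H` by a clique of size
`A`, vertices in distinct cliques being adjacent exactly when the underlying vertices of `H`
are adjacent. -/
def cliqueExt {W : Type*} (H : SimpleGraph W) (A : ℕ) : SimpleGraph (W × Fin A) :=
  SimpleGraph.fromRel (fun p q => H.Adj p.1 q.1 ∨ p.1 = q.1)

/-- `θ` is an eigenvalue of the adjacency matrix of `G`. -/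
def IsAdjEigenvalue [Fintype V] (G : SimpleGraph V) [DecidableRel G.Adj] (θ : ℝ) : Prop :=
  ∃ v : V → ℝ, v ≠ 0 ∧ (G.adjMatrix ℝ).mulVec v = θ • v

/-- `w` lies on `C` or is adjacent to a vertex of `C`. -/
def Near (G : SimpleGraph V) (w : V) (C : Finset V) : Prop :=
  ∃ u ∈ C, u = w ∨ G.Adj w u

/-- Every vertex of `C` lies on or is adjacent to a vertex of `C'`. -/
def AllNear (G : SimpleGraph V) (C C' : Finset V) : Prop :=
  ∀ q ∈ C, Near G q C'

theorem near_of_mem {G : SimpleGraph V} {w : V} {C : Finset V} (hw : w ∈ C) : Near G w C :=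
  ⟨w, hw, Or.inl rfl⟩

theorem near_of_adj {G : SimpleGraph V} {w u : V} {C : Finset V} (hu : u ∈ C)
    (h : G.Adj w u) : Near G w C :=
  ⟨u, hu, Or.inr h⟩

theorem Near.exists_adj {G : SimpleGraph V} {w : V} {C : Finset V} (h : Near G w C) (hw : w ∉ C) :
    ∃ u ∈ C, G.Adj w u := by
  obtain ⟨u, hu, rfl | h⟩ := h
  · exact absurd hu hw
  · exact ⟨u, hu, h⟩

/-- `L` is a set of cliques covering each edge exactly once. -/
structure IsCliqueCover (G : SimpleGraph V) (L : Finset (Finset V)) : Prop where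
  adj : ∀ C ∈ L, ∀ x ∈ C, ∀ y ∈ C, x ≠ y → G.Adj x y
  exists_line : ∀ x y, G.Adj x y → ∃ C ∈ L, x ∈ C ∧ y ∈ C
  unique : ∀ C ∈ L, ∀ C' ∈ L, ∀ x y, x ≠ y → x ∈ C → y ∈ C → x ∈ C' → y ∈ C' → C = C'

open scoped Classical in
/-- The combinatorial properties of the line set of a geometric distance-regular graph with
classical parameters that only involve distances at most `2`. -/
structure LineSystem (G : SimpleGraph V) (L : Finset (Finset V)) (r b α β : ℝ) : Prop
    extends IsCliqueCover G L where
  card_line : ∀ C ∈ L, (C.card : ℝ) = β + 1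
  card_through : ∀ x, ((L.filter fun C => x ∈ C).card : ℝ) = r
  card_nbr : ∀ C ∈ L, ∀ x, x ∉ C → Near G x C → ((C.filter fun u => G.Adj x u).card : ℝ) = 1 + α
  card_two : ∀ C ∈ L, ∀ x, ¬ Near G x C →
    ((C.filter fun u => ∃ v, G.Adj x v ∧ G.Adj v u).card : ℝ) ≤ 1 + α * (1 + b)
  card_block : ∀ x y, x ≠ y → ¬ G.Adj x y → (∃ v, G.Adj x v ∧ G.Adj v y) →
    ((L.filter fun C => x ∈ C ∧ Near G y C).card : ℝ) = b + 1
  one_le_alpha : 1 ≤ α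
  alpha_le : α ≤ b - 1
  le_r : 1 + b + b ^ 2 ≤ r
  lt_beta : (r - α - 1) * α * b + α < β

namespace LineSystem

variable {G : SimpleGraph V} {L : Finset (Finset V)} {r b α β : ℝ}

theorem lt_beta_mul (h : LineSystem G L r b α β) : α * (1 + b) + 2 < β := by
  have h1 := h.one_le_alpha
  have h2 := h.alpha_le
  have h3 := h.le_r
  have h4 := h.lt_beta
  have h5 : 3 ≤ r - α - 1 := by nlinarith
  have h6 : 2 ≤ α * b := by nlinarith
  nlinarith

/-- A vertex of a line meeting `C` is near `C`. -/
theorem near_of_meet (h : LineSystem G L r b α β) {C C' : Finset V} (hC : C ∈ L) {x w : V}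
    (hx : x ∈ C) (hx' : x ∈ C') (hw : w ∈ C) : Near G w C' := by
  by_cases e : w = x
  · subst e; exact near_of_mem hx'
  · exact near_of_adj hx' (h.adj C hC w hw x hx e)

open scoped Classical in
theorem allNear_of_card (h : LineSystem G L r b α β) {C C' : Finset V} (hC : C ∈ L)
    (hC' : C' ∈ L) (hcard : 1 + α * (1 + b) < ((C.filter fun q => Near G q C').card : ℝ)) :
    AllNear G C' C := by
  intro p hp
  by_contra hn
  refine absurd (h.card_two C hC p hn) (not_le.2 (hcard.trans_le ?_))
  norm_cast
  refine Finset.card_le_card fun q hq => ?_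
  simp only [Finset.mem_filter] at hq ⊢
  refine ⟨hq.1, ?_⟩
  obtain ⟨u, hu, rfl | hqu⟩ := hq.2
  · exact absurd (h.near_of_meet hC' hu hq.1 hp) hn
  · refine ⟨u, h.adj C' hC' p hp u hu ?_, hqu.symm⟩
    rintro rfl
    exact hn (near_of_adj hq.1 hqu.symm)

theorem allNear_symm (h : LineSystem G L r b α β) {C C' : Finset V} (hC : C ∈ L)
    (hC' : C' ∈ L) (hn : AllNear G C C') : AllNear G C' C := by
  classical
  apply h.allNear_of_card hC hC'
  rw [Finset.filter_true_of_mem hn, h.card_line C hC]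
  linarith [h.lt_beta_mul]

/-- A vertex off a line and near to it has a non-neighbour on it. -/
theorem exists_not_adj (h : LineSystem G L r b α β) {C : Finset V} (hC : C ∈ L) {z : V}
    (hz : z ∉ C) (hn : Near G z C) : ∃ q ∈ C, ¬ G.Adj z q := by
  classical
  by_contra! hc
  have h1 := h.card_nbr C hC z hz hn
  rw [Finset.filter_true_of_mem hc, h.card_line C hC] at h1
  nlinarith [h.lt_beta_mul, h.one_le_alpha, h.alpha_le]

/-- If `z` and `w` are off the line `C` and near to it and some neighbour of `z` on `C` is not
a neighbour of `w`, then some neighbour of `w` on `C` is not a neighbour of `z`. -/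
theorem exists_adj_not_adj (h : LineSystem G L r b α β) {C : Finset V} (hC : C ∈ L) {z w p : V}
    (hz : z ∉ C) (hw : w ∉ C) (hnw : Near G w C) (hp : p ∈ C) (hzp : G.Adj z p)
    (hwp : ¬ G.Adj w p) : ∃ q ∈ C, G.Adj w q ∧ ¬ G.Adj z q := by
  classical
  by_contra! hc
  have h1 := h.card_nbr C hC z hz (near_of_adj hp hzp)
  have h2 := h.card_nbr C hC w hw hnw
  rw [← h1] at h2
  norm_cast at h2
  have h3 : (C.filter fun u => G.Adj w u) = C.filter fun u => G.Adj z u := by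
    refine Finset.eq_of_subset_of_card_le (fun q hq => ?_) h2.ge
    simp only [Finset.mem_filter] at hq ⊢
    exact ⟨hq.1, hc q hq.1 hq.2⟩
  have h4 : p ∈ C.filter fun u => G.Adj w u := by
    rw [h3]; simp [hp, hzp]
  simp only [Finset.mem_filter] at h4
  exact hwp h4.2

open scoped Classical in
/-- The lines through `z` that meet the line `C` correspond to the neighbours of `z` on `C`. -/
theorem card_meet (h : LineSystem G L r b α β) {C : Finset V} (hC : C ∈ L) {z : V}
    (hz : z ∉ C) (hn : Near G z C) :
    ((L.filter fun m => z ∈ m ∧ ∃ u ∈ C, u ∈ m).card : ℝ) = 1 + α := by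
  rw [← h.card_nbr C hC z hz hn]
  norm_cast
  symm
  have key : ∀ u, G.Adj z u → ∃ m ∈ L, z ∈ m ∧ u ∈ m := fun u hu => h.exists_line z u hu
  choose! f hf using key
  refine Finset.card_bij (fun u _ => f u) ?_ ?_ ?_
  · intro u hu
    simp only [Finset.mem_filter] at hu ⊢
    obtain ⟨h1, h2, h3⟩ := hf u hu.2
    exact ⟨h1, h2, u, hu.1, h3⟩
  · intro u hu v hv huv
    simp only [Finset.mem_filter] at hu hv
    by_contra hne
    obtain ⟨h1, h2, h3⟩ := hf u hu.2
    obtain ⟨-, -, h4⟩ := hf v hv.2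
    rw [← huv] at h4
    exact hz (h.unique C hC _ h1 u v hne hu.1 hv.1 h3 h4 ▸ h2)
  · intro m hm
    simp only [Finset.mem_filter] at hm
    obtain ⟨hm, hzm, u, huC, hum⟩ := hm
    have hadj : G.Adj z u := h.adj m hm z hzm u hum (by rintro rfl; exact hz huC)
    refine ⟨u, by simp [huC, hadj], ?_⟩
    obtain ⟨h1, h2, h3⟩ := hf u hadj
    exact h.unique _ h1 m hm z u hadj.ne h2 h3 hzm hum

open scoped Classical in
/-- For `z` off the line `C` and a line `m` through `z`, at most `αb` non-neighbours of `z` on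
`C` are near `m`, unless all vertices of `C` are. -/
theorem card_near_not_adj (h : LineSystem G L r b α β) {C m : Finset V} (hC : C ∈ L)
    (hm : m ∈ L) {z : V} (hz : z ∉ C) (hn : Near G z C) (hzm : z ∈ m)
    (hnot : ¬ AllNear G C m) :
    ((C.filter fun q => ¬ G.Adj z q ∧ Near G q m).card : ℝ) ≤ α * b := by
  by_contra! hlt
  refine hnot (h.allNear_symm hm hC (h.allNear_of_card hC hm ?_))
  have h1 := h.card_nbr C hC z hz hn
  have h2 : (C.filter fun u => G.Adj z u).card + (C.filter fun q => ¬ G.Adj z q ∧ Near G q m).card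
      ≤ (C.filter fun q => Near G q m).card := by
    rw [← Finset.card_union_of_disjoint]
    · refine Finset.card_le_card fun q hq => ?_
      simp only [Finset.mem_union, Finset.mem_filter] at hq ⊢
      rcases hq with hq | hq
      · exact ⟨hq.1, near_of_adj hzm hq.2.symm⟩
      · exact ⟨hq.1, hq.2.2⟩
    · rw [Finset.disjoint_left]
      intro q hq hq'
      simp only [Finset.mem_filter] at hq hq'
      exact hq'.2.1 hq.2
  have h3 : ((C.filter fun u => G.Adj z u).card : ℝ)
      + ((C.filter fun q => ¬ G.Adj z q ∧ Near G q m).card : ℝ)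
      ≤ ((C.filter fun q => Near G q m).card : ℝ) := by exact_mod_cast h2
  linarith

/-- If `z` is off the line `C` and near to it, a line through `z` near one non-neighbour of `z`
on `C` is near all vertices of `C`. -/
theorem allNear_of_near (h : LineSystem G L r b α β) {C m : Finset V} (hC : C ∈ L) (hm : m ∈ L)
    {z q : V} (hz : z ∉ C) (hn : Near G z C) (hzm : z ∈ m) (hq : q ∈ C) (hzq : ¬ G.Adj z q)
    (hqm : Near G q m) : AllNear G C m := by
  classical
  by_contra hnot
  obtain ⟨c, hc, hzc⟩ := hn.exists_adj hz
  set F := L.filter fun m => z ∈ m ∧ AllNear G C m with hF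
  have hblock : ∀ p ∈ C, ¬ G.Adj z p →
      ((L.filter fun m => z ∈ m ∧ Near G p m).card : ℝ) = b + 1 := by
    intro p hp hzp
    refine h.card_block z p (by rintro rfl; exact hz hp) hzp ⟨c, hzc, ?_⟩
    exact h.adj C hC c hc p hp (by rintro rfl; exact hzp hzc)
  have hFlt : (F.card : ℝ) < b + 1 := by
    rw [← hblock q hq hzq]
    norm_cast
    refine Finset.card_lt_card ⟨fun m' hm' => ?_, fun hsub => ?_⟩
    · simp only [hF, Finset.mem_filter] at hm' ⊢
      exact ⟨hm'.1, hm'.2.1, hm'.2.2 q hq⟩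
    · have := hsub (show m ∈ _ by simp [hm, hzm, hqm])
      simp only [hF, Finset.mem_filter] at this
      exact hnot this.2.2
  have hex : ∀ p, p ∈ C → ¬ G.Adj z p → ∃ m' ∈ L, z ∈ m' ∧ Near G p m' ∧ ¬ AllNear G C m' := by
    intro p hp hzp
    by_contra! hall
    have : (L.filter fun m => z ∈ m ∧ Near G p m).card ≤ F.card := by
      refine Finset.card_le_card fun m' hm' => ?_
      simp only [hF, Finset.mem_filter] at hm' ⊢
      exact ⟨hm'.1, hm'.2.1, hall m' hm'.1 hm'.2.1 hm'.2.2⟩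
    have h' : ((L.filter fun m => z ∈ m ∧ Near G p m).card : ℝ) ≤ F.card := by exact_mod_cast this
    rw [hblock p hp hzp] at h'
    linarith
  choose! f hf using hex
  set N := C.filter fun p => ¬ G.Adj z p with hN
  set T := L.filter fun m => z ∈ m ∧ ¬ AllNear G C m with hT
  have hNcard : (N.card : ℝ) = β - α := by
    have h1 := Finset.card_filter_add_card_filter_not (s := C) (fun p => G.Adj z p)
    have h2 := h.card_nbr C hC z hz hn
    have h3 := h.card_line C hC
    rw [← h1] at h3
    push_cast at h3
    linarith
  have hTcard : (T.card : ℝ) ≤ r - α - 1 := by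
    have h1 := h.card_meet hC hz hn
    have h2 := h.card_through z
    have h3 : T.card + (L.filter fun m => z ∈ m ∧ ∃ u ∈ C, u ∈ m).card
        ≤ (L.filter fun C => z ∈ C).card := by
      rw [← Finset.card_union_of_disjoint]
      · refine Finset.card_le_card fun q hq => ?_
        simp only [hT, Finset.mem_union, Finset.mem_filter] at hq ⊢
        tauto
      · rw [Finset.disjoint_left]
        intro m' hm' hm''
        simp only [hT, Finset.mem_filter] at hm' hm''
        obtain ⟨u, hu, hu'⟩ := hm''.2.2
        exact hm'.2.2 fun p hp => h.near_of_meet hC hu hu' hp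
    have h4 : (T.card : ℝ) + ((L.filter fun m => z ∈ m ∧ ∃ u ∈ C, u ∈ m).card : ℝ)
        ≤ ((L.filter fun C => z ∈ C).card : ℝ) := by exact_mod_cast h3
    linarith
  have hsum : (N.card : ℝ) ≤ T.card * (α * b) := by
    have hmaps : ∀ p ∈ N, f p ∈ T := by
      intro p hp
      simp only [hN, Finset.mem_filter] at hp
      obtain ⟨h1, h2, -, h3⟩ := hf p hp.1 hp.2
      simp only [hT, Finset.mem_filter]
      exact ⟨h1, h2, h3⟩
    rw [Finset.card_eq_sum_card_fiberwise hmaps, ← nsmul_eq_mul]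
    push_cast
    refine Finset.sum_le_card_nsmul _ _ _ fun m' hm' => ?_
    simp only [hT, Finset.mem_filter] at hm'
    refine le_trans ?_ (h.card_near_not_adj hC hm'.1 hz hn hm'.2.1 hm'.2.2)
    norm_cast
    refine Finset.card_le_card fun p hp => ?_
    simp only [hN, Finset.mem_filter] at hp ⊢
    obtain ⟨h1, h2, h3, -⟩ := hf p hp.1.1 hp.1.2
    rw [hp.2] at h3
    exact ⟨hp.1.1, hp.1.2, h3⟩
  have hpos : 0 ≤ α * b := by nlinarith [h.one_le_alpha, h.alpha_le]
  have := mul_le_mul_of_nonneg_right hTcard hpos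
  nlinarith [h.lt_beta]

open scoped Classical in
theorem card_allNear (h : LineSystem G L r b α β) {C : Finset V} (hC : C ∈ L) {z : V}
    (hz : z ∉ C) (hn : Near G z C) :
    ((L.filter fun m => z ∈ m ∧ AllNear G C m).card : ℝ) = b + 1 := by
  obtain ⟨q, hq, hzq⟩ := h.exists_not_adj hC hz hn
  obtain ⟨c, hc, hzc⟩ := hn.exists_adj hz
  rw [← h.card_block z q (by rintro rfl; exact hz hq) hzq
    ⟨c, hzc, h.adj C hC c hc q hq (by rintro rfl; exact hzq hzc)⟩]
  congr 2
  ext m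
  simp only [and_congr_right_iff, Finset.mem_filter]
  exact fun hm hzm => ⟨fun ha => ha q hq, h.allNear_of_near hC hm hz hn hzm hq hzq⟩

/-- Let `z` and `p` be vertices of the line `C` and let `w` be near `C` and adjacent to neither
of them. If `n ≠ C` is a line through `p` near `w`, then a line through `z` is near `w` if and
only if it is near all vertices of `n`. -/
theorem near_iff_allNear (h : LineSystem G L r b α β) {C n m : Finset V} (hC : C ∈ L)
    (hn : n ∈ L) (hm : m ∈ L) {z p w : V} (hzC : z ∈ C) (hpC : p ∈ C) (hzp : z ≠ p)
    (hw : w ∉ C) (hwC : Near G w C) (hwz : ¬ G.Adj w z) (hwp : ¬ G.Adj w p) (hpn : p ∈ n)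
    (hnC : n ≠ C) (hwn : Near G w n) (hzm : z ∈ m) : Near G w m ↔ AllNear G n m := by
  have hzn : z ∉ n := fun hzn => hnC (h.unique n hn C hC z p hzp hzn hpn hzC hpC)
  have hwn' : w ∉ n := fun hwn' =>
    hwp (h.adj n hn w hwn' p hpn (by rintro rfl; exact hw hpC))
  obtain ⟨q, hqn, hwq, hzq⟩ := h.exists_adj_not_adj hn hzn hwn' hwn hpn
    (h.adj C hC z hzC p hpC hzp) hwp
  obtain ⟨t, ht, hwt, hqt⟩ := h.exists_line w q hwq
  have hpq : G.Adj p q := h.adj n hn p hpn q hqn (by rintro rfl; exact hwp hwq)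
  have hCt : AllNear G C t :=
    h.allNear_of_near hC ht hw hwC hwt hpC hwp (near_of_adj hqt hpq)
  have hzt : z ∉ t := fun hzt => hwz (h.adj t ht w hwt z hzt (by rintro rfl; exact hw hzC))
  have hznear : Near G z t := hCt z hzC
  have hzpn : Near G z n := near_of_adj hpn (h.adj C hC z hzC p hpC hzp)
  constructor
  · intro hwm
    have h1 := h.allNear_of_near ht hm hzt hznear hzm hwt (fun e => hwz e.symm) hwm
    exact h.allNear_of_near hn hm hzn hzpn hzm hqn hzq (h1 q hqt)
  · intro hnm
    exact h.allNear_of_near ht hm hzt hznear hzm hqt hzq (hnm q hqn) w hwt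

open scoped Classical in
/-- Two lines through `z` lie in at most one common block. -/
theorem near_of_block (h : LineSystem G L r b α β) {C C' m : Finset V} (hC : C ∈ L)
    (hC' : C' ∈ L) (hm : m ∈ L) (hne : C ≠ C') {z w w' : V} (hzC : z ∈ C) (hzC' : z ∈ C')
    (hzm : z ∈ m) (hzw : z ≠ w) (hwz : ¬ G.Adj w z) (hzw' : z ≠ w') (hwz' : ¬ G.Adj w' z)
    (hwC : Near G w C) (hwC' : Near G w C') (hw'C : Near G w' C) (hw'C' : Near G w' C')
    (hwm : Near G w m) : Near G w' m := by
  have hoff : ∀ v, z ≠ v → ¬ G.Adj v z → v ∉ C := fun v hv hvz hvC =>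
    hvz (h.adj C hC v hvC z hzC hv.symm)
  have hw := hoff w hzw hwz
  have hw' := hoff w' hzw' hwz'
  obtain ⟨p, hpC, hzp, hwp, hwp'⟩ : ∃ p ∈ C, z ≠ p ∧ ¬ G.Adj w p ∧ ¬ G.Adj w' p := by
    by_contra! hc
    have hsub : C ⊆ {z} ∪ ((C.filter fun u => G.Adj w u) ∪ (C.filter fun u => G.Adj w' u)) := by
      intro p hp
      have := hc p hp
      simp only [Finset.mem_union, Finset.mem_singleton, Finset.mem_filter]
      tauto
    have h1 := (Finset.card_le_card hsub).trans ((Finset.card_union_le _ _).trans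
      (Nat.add_le_add_left (Finset.card_union_le _ _) _))
    have h2 : (C.card : ℝ) ≤ 1 + (((C.filter fun u => G.Adj w u).card : ℝ) +
        ((C.filter fun u => G.Adj w' u).card : ℝ)) := by
      rw [Finset.card_singleton] at h1
      exact_mod_cast h1
    rw [h.card_line C hC, h.card_nbr C hC w hw hwC, h.card_nbr C hC w' hw' hw'C] at h2
    nlinarith [h.lt_beta_mul, h.one_le_alpha, h.alpha_le]
  have hpC' : p ∉ C' := fun hp => hne (h.unique C hC C' hC' z p hzp hzC hpC hzC' hp)
  have hpnear : Near G p C' := near_of_adj hzC' (h.adj C hC p hpC z hzC hzp.symm)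
  have hblk : ∀ v, v ∉ C → Near G v C → ¬ G.Adj v z → ¬ G.Adj v p → Near G v C' →
      (L.filter fun n => p ∈ n ∧ Near G v n) = L.filter fun n => p ∈ n ∧ AllNear G C' n := by
    intro v hv hvC hvz hvp hvC'
    apply Finset.eq_of_subset_of_card_le
    · intro n hn
      simp only [Finset.mem_filter] at hn ⊢
      refine ⟨hn.1, hn.2.1, ?_⟩
      by_cases hnC : n = C
      · subst hnC
        exact fun q hq => h.near_of_meet hC' hzC' hzC hq
      · exact h.allNear_symm hn.1 hC' ((h.near_iff_allNear hC hn.1 hC' hzC hpC hzp hv hvC hvz hvp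
          hn.2.1 hnC hn.2.2 hzC').1 hvC')
    · have h1 := h.card_allNear hC' hpC' hpnear
      obtain ⟨c, hc, hvc⟩ := hvC.exists_adj hv
      rw [← h.card_block p v (by rintro rfl; exact hv hpC) (fun e => hvp e.symm)
        ⟨c, h.adj C hC p hpC c hc (by rintro rfl; exact hvp hvc), hvc.symm⟩] at h1
      exact_mod_cast h1.le
  obtain ⟨n, hn, hnC⟩ : ∃ n ∈ L.filter fun n => p ∈ n ∧ AllNear G C' n, n ≠ C := by
    by_contra! hc
    have h1 : (L.filter fun n => p ∈ n ∧ AllNear G C' n).card ≤ 1 :=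
      (Finset.card_le_card (t := {C}) fun n hn => Finset.mem_singleton.2 (hc n hn)).trans
        (Finset.card_singleton C).le
    have h2 : ((L.filter fun n => p ∈ n ∧ AllNear G C' n).card : ℝ) ≤ 1 := by exact_mod_cast h1
    rw [h.card_allNear hC' hpC' hpnear] at h2
    linarith [h.one_le_alpha, h.alpha_le]
  have hn1 := hn
  have hn2 := hn
  rw [← hblk w hw hwC hwz hwp hwC'] at hn1
  rw [← hblk w' hw' hw'C hwz' hwp' hw'C'] at hn2
  simp only [Finset.mem_filter] at hn1 hn2
  rw [h.near_iff_allNear hC hn1.1 hm hzC hpC hzp hw' hw'C hwz' hwp' hn1.2.1 hnC hn2.2.2 hzm]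
  exact (h.near_iff_allNear hC hn1.1 hm hzC hpC hzp hw hwC hwz hwp hn1.2.1 hnC hn1.2.2 hzm).1 hwm

/-- If `y`, `z`, `w` lie on three lines through `x` and `y` is adjacent to `z` and `w`, but `z`
and `w` are not adjacent, then the three lines lie in a common block. -/
theorem exists_block (h : LineSystem G L r b α β) {C₁ C₂ C₃ : Finset V} (h₁ : C₁ ∈ L)
    (h₂ : C₂ ∈ L) (h₃ : C₃ ∈ L) (h₁₂ : C₁ ≠ C₂) (h₂₃ : C₂ ≠ C₃)
    {x y z w : V} (hx₁ : x ∈ C₁) (hx₂ : x ∈ C₂) (hx₃ : x ∈ C₃) (hy : y ∈ C₁) (hz : z ∈ C₂)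
    (hw : w ∈ C₃) (hxy : x ≠ y) (hxz : x ≠ z) (hxw : x ≠ w) (hyz : G.Adj y z)
    (hyw : G.Adj y w) (hzw : ¬ G.Adj z w) :
    ∃ u, x ≠ u ∧ ¬ G.Adj u x ∧ Near G u C₁ ∧ Near G u C₂ ∧ Near G u C₃ := by
  classical
  have hz₁ : z ∉ C₁ := fun hz₁ => h₁₂ (h.unique C₁ h₁ C₂ h₂ x z hxz hx₁ hz₁ hx₂ hz)
  have hzw' : z ≠ w := by
    rintro rfl
    exact h₂₃ (h.unique C₂ h₂ C₃ h₃ x z hxz hx₂ hz hx₃ hw)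
  have hxzadj : G.Adj x z := h.adj C₂ h₂ x hx₂ z hz hxz
  have hxwadj : G.Adj x w := h.adj C₃ h₃ x hx₃ w hw hxw
  have hnz : Near G z C₁ := near_of_adj hx₁ hxzadj.symm
  obtain ⟨m, hm, hzm, hpar, hdisj⟩ :
      ∃ m ∈ L, z ∈ m ∧ AllNear G C₁ m ∧ ∀ u ∈ C₁, u ∉ m := by
    by_contra! hc
    have h1 : (L.filter fun m => z ∈ m ∧ AllNear G C₁ m).card
        ≤ (L.filter fun m => z ∈ m ∧ ∃ u ∈ C₁, u ∈ m).card := by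
      refine Finset.card_le_card fun m hm => ?_
      simp only [Finset.mem_filter] at hm ⊢
      exact ⟨hm.1, hm.2.1, hc m hm.1 hm.2.1 hm.2.2⟩
    have h2 : ((L.filter fun m => z ∈ m ∧ AllNear G C₁ m).card : ℝ)
        ≤ ((L.filter fun m => z ∈ m ∧ ∃ u ∈ C₁, u ∈ m).card : ℝ) := by exact_mod_cast h1
    rw [h.card_allNear h₁ hz₁ hnz, h.card_meet h₁ hz₁ hnz] at h2
    linarith [h.alpha_le]
  obtain ⟨y', hy', hzy'⟩ := h.exists_not_adj h₁ hz₁ hnz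
  obtain ⟨n, hn, hyn, hzn⟩ := h.exists_line y z hyz
  have hn₂ : C₂ ≠ n := by
    rintro rfl
    exact h₁₂ (h.unique C₁ h₁ C₂ h₂ x y hxy hx₁ hy hx₂ hyn)
  have hwm : Near G w m :=
    h.near_of_block (w := y') (w' := w) h₂ hn hm hn₂ hz hzn hzm (by rintro rfl; exact hz₁ hy')
      (fun e => hzy' e.symm) hzw' (fun e => hzw e.symm) (h.near_of_meet h₁ hx₁ hx₂ hy')
      (h.near_of_meet h₁ hy hyn hy') (near_of_adj hx₂ hxwadj.symm) (near_of_adj hyn hyw.symm)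
      (hpar y' hy')
  have hwm' : w ∉ m := fun hwm' => hzw (h.adj m hm z hzm w hwm' hzw')
  obtain ⟨u, hum, hwu, hxu⟩ := h.exists_adj_not_adj hm (hdisj x hx₁) hwm' hwm hzm hxzadj
    (fun e => hzw e.symm)
  exact ⟨u, by rintro rfl; exact hdisj x hx₁ hum, fun e => hxu e.symm,
    h.allNear_symm h₁ hm hpar u hum, h.near_of_meet hm hzm hz hum, near_of_adj hw hwu.symm⟩

/-- The dual Pasch axiom. -/
theorem dual_pasch (h : LineSystem G L r b α β) {C₁ : Finset V} (h₁ : C₁ ∈ L)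
    {x y z w : V} (hx₁ : x ∈ C₁) (hy : y ∈ C₁) (hxy : x ≠ y) (hxz : G.Adj x z)
    (hyz : G.Adj y z) (hz : z ∉ C₁) (hxw : G.Adj x w) (hyw : G.Adj y w) (hw : w ∉ C₁)
    (hne : z ≠ w) : G.Adj z w := by
  classical
  by_contra hzw
  obtain ⟨C₂, h₂, hx₂, hz₂⟩ := h.exists_line x z hxz
  obtain ⟨C₃, h₃, hx₃, hw₃⟩ := h.exists_line x w hxw
  have h₁₂ : C₁ ≠ C₂ := by rintro rfl; exact hz hz₂
  have h₁₃ : C₁ ≠ C₃ := by rintro rfl; exact hw hw₃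
  have h₂₃ : C₂ ≠ C₃ := by rintro rfl; exact hzw (h.adj C₂ h₂ z hz₂ w hw₃ hne)
  obtain ⟨u, hxu, hux, hu₁, hu₂, hu₃⟩ := h.exists_block h₁ h₂ h₃ h₁₂ h₂₃ hx₁ hx₂ hx₃ hy hz₂
    hw₃ hxy hxz.ne hxw.ne hyz hyw hzw
  have hu₁' : u ∉ C₁ := fun hu => hux (h.adj C₁ h₁ u hu x hx₁ hxu.symm)
  obtain ⟨C₄, h₄, hx₄, hu₄⟩ : ∃ C₄ ∈ L, x ∈ C₄ ∧ ¬ Near G u C₄ := by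
    by_contra! hc
    obtain ⟨c, hc₁, huc⟩ := hu₁.exists_adj hu₁'
    have h1 := h.card_block x u hxu (fun e => hux e.symm)
      ⟨c, h.adj C₁ h₁ x hx₁ c hc₁ (by rintro rfl; exact hux huc), huc.symm⟩
    have h2 : (L.filter fun C => x ∈ C ∧ Near G u C) = L.filter fun C => x ∈ C := by
      ext C
      simp only [Finset.mem_filter]
      exact ⟨fun a => ⟨a.1, a.2.1⟩, fun a => ⟨a.1, a.2, hc C a.1 a.2⟩⟩
    rw [h2, h.card_through x] at h1
    nlinarith [h.le_r, h.one_le_alpha, h.alpha_le]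
  have hne₄ : ∀ C, Near G u C → C ≠ C₄ := by rintro C hC rfl; exact hu₄ hC
  have noBlock : ∀ C ∈ L, ∀ C' ∈ L, C ≠ C' → x ∈ C → x ∈ C' → Near G u C → Near G u C' →
      ¬ ∃ v, x ≠ v ∧ ¬ G.Adj v x ∧ Near G v C ∧ Near G v C' ∧ Near G v C₄ := by
    rintro C hC C' hC' hCC' hxC hxC' huC huC' ⟨v, hxv, hvx, hvC, hvC', hv₄⟩
    exact hu₄ (h.near_of_block hC hC' h₄ hCC' hxC hxC' hx₄ hxv hvx hxu hux hvC hvC' huC huC' hv₄)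
  obtain ⟨v, hv₄, hxv, hyv⟩ : ∃ v ∈ C₄, x ≠ v ∧ G.Adj y v := by
    by_contra! hc
    have hy₄ : y ∉ C₄ := fun hy₄ => hne₄ C₁ hu₁ (h.unique C₁ h₁ C₄ h₄ x y hxy hx₁ hy hx₄ hy₄)
    have h1 := h.card_nbr C₄ h₄ y hy₄ (near_of_adj hx₄ (h.adj C₁ h₁ y hy x hx₁ hxy.symm))
    have h2 : (C₄.filter fun u => G.Adj y u).card ≤ 1 := by
      refine (Finset.card_le_card (t := {x}) fun v hv => ?_).trans (Finset.card_singleton x).le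
      simp only [Finset.mem_filter, Finset.mem_singleton] at hv ⊢
      by_contra hvx
      exact hc v hv.1 (fun e => hvx e.symm) hv.2
    have h3 : ((C₄.filter fun u => G.Adj y u).card : ℝ) ≤ 1 := by exact_mod_cast h2
    linarith [h.one_le_alpha]
  have hvz : G.Adj z v := by
    by_contra hzv
    exact noBlock C₁ h₁ C₂ h₂ h₁₂ hx₁ hx₂ hu₁ hu₂ (h.exists_block h₁ h₂ h₄ h₁₂ (hne₄ C₂ hu₂) hx₁
      hx₂ hx₄ hy hz₂ hv₄ hxy hxz.ne hxv hyz hyv hzv)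
  have hvw : G.Adj w v := by
    by_contra hwv
    exact noBlock C₁ h₁ C₃ h₃ h₁₃ hx₁ hx₃ hu₁ hu₃ (h.exists_block h₁ h₃ h₄ h₁₃ (hne₄ C₃ hu₃) hx₁
      hx₃ hx₄ hy hw₃ hv₄ hxy hxw.ne hxv hyw hyv hwv)
  obtain ⟨u', h1, h2, h3, h4, h5⟩ := h.exists_block h₄ h₂ h₃ (hne₄ C₂ hu₂).symm h₂₃ hx₄ hx₂ hx₃
    hv₄ hz₂ hw₃ hxv hxz.ne hxw.ne hvz.symm hvw.symm hzw
  exact noBlock C₂ h₂ C₃ h₃ h₂₃ hx₂ hx₃ hu₂ hu₃ ⟨u', h1, h2, h4, h5, h3⟩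

end LineSystem

section Cosine

theorem gauss_zero (b : ℕ) : gauss b 0 = 0 := by simp [gauss]

theorem gauss_one (b : ℕ) : gauss b 1 = 1 := by simp [gauss]

theorem gauss_two (b : ℕ) : gauss b 2 = 1 + b := by simp [gauss, Finset.sum_range_succ]

theorem gauss_succ (b j : ℕ) : gauss b (j + 1) = 1 + b * gauss b j := by
  simp [gauss, Finset.sum_range_succ', Finset.mul_sum, pow_succ']
  ring

theorem gauss_mono (b : ℕ) : Monotone (gauss b) := fun i j hij =>
  Finset.sum_le_sum_of_subset_of_nonneg (Finset.range_mono hij) fun _ _ _ => by positivity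

theorem gauss_nonneg (b j : ℕ) : 0 ≤ gauss b j := Finset.sum_nonneg fun _ _ => by positivity

/-- The standard sequence of the eigenvalue `-[D]` of a graph with classical parameters. -/
noncomputable def cosine (b : ℕ) (α β : ℝ) : ℕ → ℝ
  | 0 => 1
  | i + 1 => cosine b α β i * (-(1 + α * gauss b i) / (β - α * gauss b i))

theorem mul_gauss_lt {D b i : ℕ} {α β : ℝ} (hb : 2 ≤ b) (hD : 3 ≤ D)
    (hα : 1 ≤ α ∧ α ≤ (b : ℝ) - 1) (hβ : (gauss b D - α - 1) * α * (b : ℝ) + α < β) (hi : i < D) :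
    α * gauss b i < β := by
  obtain ⟨d, rfl⟩ : ∃ d, D = d + 1 := ⟨D - 1, by omega⟩
  have h1 : gauss b i ≤ gauss b d := gauss_mono b (by omega)
  have h2 : gauss b 2 ≤ gauss b d := gauss_mono b (by omega)
  rw [gauss_two] at h2
  rw [gauss_succ] at hβ
  have hb' : (2 : ℝ) ≤ b := by exact_mod_cast hb
  obtain ⟨hα1, hα2⟩ := hα
  set g := gauss b d
  have h3 : g ≤ (b * g - α) * b + 1 := by
    have h5 : g ≤ b * g - α := by nlinarith
    nlinarith
  have h4 : α * gauss b i ≤ α * ((b * g - α) * b + 1) := by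
    apply mul_le_mul_of_nonneg_left (by linarith) (by linarith)
  linarith

end Cosine

section Counting

variable [Fintype V] {G : SimpleGraph V} {D b : ℕ} {α β : ℝ} {cc aa bb : ℕ → ℕ}

open scoped Classical in
/-- The sum over the neighbours of `y` of a function of the distance to `x`. -/
theorem IsDRG.sum_adj (h : IsDRG G D cc aa bb) (f : ℕ → ℝ) {x y : V} (hxy : x ≠ y) :
    ∑ z ∈ Finset.univ.filter (G.Adj y), f (G.dist x z) =
      cc (G.dist x y) * f (G.dist x y - 1) + aa (G.dist x y) * f (G.dist x y)
        + bb (G.dist x y) * f (G.dist x y + 1) := by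
  obtain ⟨hconn, hle, -, hcount⟩ := h
  obtain ⟨h1, h2, h3⟩ := hcount _ (hle x y) x y rfl
  have hpos : 0 < G.dist x y := hconn.pos_dist_of_ne hxy
  set i := G.dist x y with hi
  have hf : ∀ z ∈ Finset.univ.filter (G.Adj y), f (G.dist x z) =
      (if G.dist x z = i - 1 then f (i - 1) else 0) + (if G.dist x z = i then f i else 0)
        + (if G.dist x z = i + 1 then f (i + 1) else 0) := by
    intro z hz
    simp only [Finset.mem_filter, Finset.mem_univ, true_and] at hz
    have t1 : G.dist x z ≤ i + 1 := by
      have := hconn.dist_triangle (u := x) (v := y) (w := z)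
      rwa [SimpleGraph.dist_eq_one_iff_adj.2 hz] at this
    have t2 : i ≤ G.dist x z + 1 := by
      have := hconn.dist_triangle (u := x) (v := z) (w := y)
      rwa [SimpleGraph.dist_eq_one_iff_adj.2 hz.symm] at this
    have t3 : G.dist x z = i - 1 ∨ G.dist x z = i ∨ G.dist x z = i + 1 := by omega
    rcases t3 with e | e | e
    · rw [if_pos e, if_neg (by omega), if_neg (by omega), e]; ring
    · rw [if_neg (by omega), if_pos e, if_neg (by omega), e]; ring
    · rw [if_neg (by omega), if_neg (by omega), if_pos e, e]; ring
  have hc : ∀ j n : ℕ, {z : V | G.Adj y z ∧ G.dist x z = j}.ncard = n →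
      ∑ z ∈ Finset.univ.filter (G.Adj y), (if G.dist x z = j then f j else 0) = n * f j := by
    intro j n hn
    rw [← Finset.sum_filter, Finset.filter_filter, Finset.sum_const, nsmul_eq_mul, ← hn,
      ← Set.ncard_coe_finset]
    simp
  rw [Finset.sum_congr rfl hf, Finset.sum_add_distrib, Finset.sum_add_distrib, hc _ _ h1,
    hc _ _ h2, hc _ _ h3]

open scoped Classical in
theorem HasClassicalParams.degree (h : HasClassicalParams G D b α β cc aa bb) (x : V) :
    ((Finset.univ.filter (G.Adj x)).card : ℝ) = gauss b D * β := by
  obtain ⟨-, -, h3⟩ := h.1.2.2.2 0 (Nat.zero_le _) x x (SimpleGraph.dist_self)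
  have h4 := h.2.1 0 (Nat.zero_le _)
  rw [gauss_zero] at h4
  rw [show gauss b D * β = bb 0 by rw [h4]; ring, ← h3, ← Set.ncard_coe_finset]
  congr 2
  ext z
  simp

open scoped Classical in
/-- For each vertex `x`, the function `z ↦ cosine (d(x, z))` is an eigenvector for the
eigenvalue `-[D]`. -/
theorem HasClassicalParams.sum_cosine (h : HasClassicalParams G D b α β cc aa bb) (hα : 0 ≤ α)
    (hβ : ∀ i < D, α * gauss b i < β) (hD : 0 < D) (x y : V) :
    ∑ z ∈ Finset.univ.filter (G.Adj y), cosine b α β (G.dist x z) =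
      -gauss b D * cosine b α β (G.dist x y) := by
  by_cases hxy : x = y
  · subst hxy
    have h1 : ∀ z ∈ Finset.univ.filter (G.Adj x), cosine b α β (G.dist x z) = -1 / β := by
      intro z hz
      simp only [Finset.mem_filter, Finset.mem_univ, true_and] at hz
      rw [SimpleGraph.dist_eq_one_iff_adj.2 hz]
      simp [cosine, gauss_zero]
    have h0 := hβ 0 hD
    rw [gauss_zero, mul_zero] at h0
    rw [Finset.sum_congr rfl h1, Finset.sum_const, nsmul_eq_mul, h.degree x,
      SimpleGraph.dist_self]
    simp only [cosine]
    field_simp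
  · have hpos : 0 < G.dist x y := h.1.1.pos_dist_of_ne hxy
    have hle : G.dist x y ≤ D := h.1.2.1 x y
    have hsum := h.1.sum_adj (cosine b α β) hxy
    have hone := h.1.sum_adj (fun _ => 1) hxy
    rw [Finset.sum_const, nsmul_eq_mul, h.degree y] at hone
    have hbb : (bb (G.dist x y) : ℝ) * cosine b α β (G.dist x y + 1) =
        -(gauss b D - gauss b (G.dist x y)) * (1 + α * gauss b (G.dist x y))
          * cosine b α β (G.dist x y) ∧ (bb (G.dist x y) : ℝ) =
        (gauss b D - gauss b (G.dist x y)) * (β - α * gauss b (G.dist x y)) := by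
      rcases hle.lt_or_eq with hlt | heq
      · have h2 := h.2.1 (G.dist x y) (by omega)
        refine ⟨?_, h2⟩
        have h3 : β - α * gauss b (G.dist x y) ≠ 0 := by linarith [hβ _ hlt]
        rw [h2]
        simp only [cosine]
        generalize β - α * gauss b (G.dist x y) = B at h3 ⊢
        field_simp
      · have h2 : bb (G.dist x y) = 0 := by
          rw [← (h.1.2.2.2 _ hle x y rfl).2.2, heq, Set.ncard_eq_zero]
          ext z
          have := h.1.2.1 x z
          simp only [Set.mem_ofPred_eq, Set.mem_empty_iff_false, iff_false, not_and]
          intro _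
          omega
        rw [h2, heq]
        simp
    have hcc := h.2.2 (G.dist x y) hpos hle
    rw [hsum, hbb.1]
    obtain ⟨j, hj⟩ : ∃ j, G.dist x y = j + 1 := ⟨G.dist x y - 1, by omega⟩
    have hbb2 := hbb.2
    rw [hj] at hcc hone hbb2 hle ⊢
    simp only [Nat.add_sub_cancel] at hcc hone ⊢
    have h4 : 0 < β - α * gauss b j := by linarith [hβ j (by omega)]
    have h5 : 0 < 1 + α * gauss b j := by nlinarith [gauss_nonneg b j]
    have h6 : cosine b α β j * (1 + α * gauss b j) =
        -(β - α * gauss b j) * cosine b α β (j + 1) := by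
      simp only [cosine]
      field_simp
    have h7 : (aa (j + 1) : ℝ) = gauss b D * β - cc (j + 1) - bb (j + 1) := by linarith
    rw [h7, hbb2, hcc]
    linear_combination gauss b (j + 1) * h6

end Counting

open scoped Classical in
/-- A function on `C` with two values in the ratio `-(1 + A) : (β - A)`, summing to zero, takes
the second value on exactly `1 + A` of the `β + 1` elements of `C`. -/
theorem card_of_sum_eq_zero {C : Finset V} {F : V → ℝ} {P : V → Prop} {A β u : ℝ}
    (hC : (C.card : ℝ) = β + 1) (hu : u ≠ 0) (hA : A < β) (hβ : 0 < β)
    (hP : ∀ w ∈ C, P w → F w = u)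
    (hnP : ∀ w ∈ C, ¬ P w → F w = u * (-(1 + A) / (β - A))) (hsum : ∑ w ∈ C, F w = 0) :
    ((C.filter P).card : ℝ) = 1 + A := by
  have h1 := Finset.card_filter_add_card_filter_not (s := C) P
  rw [← Finset.sum_filter_add_sum_filter_not C P,
    Finset.sum_congr rfl fun w hw => hP w (Finset.mem_filter.1 hw).1 (Finset.mem_filter.1 hw).2,
    Finset.sum_congr rfl fun w hw => hnP w (Finset.mem_filter.1 hw).1 (Finset.mem_filter.1 hw).2,
    Finset.sum_const, Finset.sum_const, nsmul_eq_mul, nsmul_eq_mul] at hsum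
  rw [← h1] at hC
  push_cast at hC
  have h2 : ((C.filter fun w => ¬ P w).card : ℝ) = β + 1 - (C.filter P).card := by linarith
  rw [h2] at hsum
  set n := ((C.filter P).card : ℝ)
  have h3 : β - A ≠ 0 := by linarith
  field_simp at hsum
  rw [mul_zero] at hsum
  have h4 : (β + 1) * (n - (1 + A)) = 0 := by
    rcases mul_eq_zero.1 hsum with h | h
    · exact absurd h hu
    · linear_combination h
  rcases mul_eq_zero.1 h4 with h | h <;> linarith

section Lines

variable [Fintype V] {G : SimpleGraph V} {L : Finset (Finset V)}

open scoped Classical in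
/-- The lines through `v` partition the neighbours of `v`. -/
theorem IsCliqueCover.sum_lines (h : IsCliqueCover G L) (F : V → ℝ) (v : V) :
    ∑ C ∈ L.filter (fun C => v ∈ C), ∑ w ∈ C.erase v, F w =
      ∑ w ∈ Finset.univ.filter (G.Adj v), F w := by
  rw [← Finset.sum_biUnion]
  · refine Finset.sum_congr ?_ fun _ _ => rfl
    ext w
    simp only [Finset.mem_biUnion, Finset.mem_filter, Finset.mem_erase, Finset.mem_univ, true_and]
    constructor
    · rintro ⟨C, ⟨hC, hv⟩, hne, hw⟩
      exact h.adj C hC v hv w hw hne.symm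
    · intro hvw
      obtain ⟨C, hC, hv, hw⟩ := h.exists_line v w hvw
      exact ⟨C, ⟨hC, hv⟩, hvw.ne', hw⟩
  · intro C hC C' hC' hne
    simp only [Finset.coe_filter, Set.mem_ofPred_eq] at hC hC'
    rw [Function.onFun, Finset.disjoint_left]
    intro w hw hw'
    simp only [Finset.mem_erase] at hw hw'
    exact hne (h.unique C hC.1 C' hC'.1 w v hw.1 hw.2 hC.2 hw'.2 hC'.2)

open scoped Classical in
/-- If each vertex lies on `r` lines, an eigenvector for the eigenvalue `-r` sums to zero on
each line. -/
theorem IsCliqueCover.sum_line_eq_zero (h : IsCliqueCover G L) {r : ℝ}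
    (hr : ∀ x, ((L.filter fun C => x ∈ C).card : ℝ) = r) {F : V → ℝ}
    (hF : ∀ v, ∑ w ∈ Finset.univ.filter (G.Adj v), F w = -r * F v) {C : Finset V} (hC : C ∈ L) :
    ∑ w ∈ C, F w = 0 := by
  have hv : ∀ v, ∑ C ∈ L.filter (fun C => v ∈ C), ∑ w ∈ C, F w = 0 := by
    intro v
    have h1 : ∑ C ∈ L.filter (fun C => v ∈ C), ∑ w ∈ C, F w =
        ∑ C ∈ L.filter (fun C => v ∈ C), (F v + ∑ w ∈ C.erase v, F w) := by
      refine Finset.sum_congr rfl fun C hC => ?_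
      rw [Finset.add_sum_erase _ _ (Finset.mem_filter.1 hC).2]
    rw [h1, Finset.sum_add_distrib, h.sum_lines, hF, Finset.sum_const, nsmul_eq_mul, hr]
    ring
  have hsq : ∑ C ∈ L, (∑ w ∈ C, F w) ^ 2 = 0 := by
    calc ∑ C ∈ L, (∑ w ∈ C, F w) ^ 2
        = ∑ C ∈ L, ∑ v ∈ C, F v * ∑ w ∈ C, F w := by
          refine Finset.sum_congr rfl fun C _ => ?_
          rw [← Finset.sum_mul, sq]
      _ = ∑ v, ∑ C ∈ L.filter (fun C => v ∈ C), F v * ∑ w ∈ C, F w :=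
          Finset.sum_comm' fun C v => by simp
      _ = 0 := by
          refine Finset.sum_eq_zero fun v _ => ?_
          rw [← Finset.mul_sum, hv, mul_zero]
  exact pow_eq_zero_iff two_ne_zero |>.1
    ((Finset.sum_eq_zero_iff_of_nonneg fun _ _ => sq_nonneg _).1 hsq C hC)

end Lines

section Classical

variable [Fintype V] {G : SimpleGraph V} {D b : ℕ} {α β : ℝ} {cc aa bb : ℕ → ℕ}

open scoped Classical in
theorem HasClassicalParams.card_through (h : HasClassicalParams G D b α β cc aa bb)
    {L : Finset (Finset V)} (hL : IsCliqueCover G L) (hcard : ∀ C ∈ L, (C.card : ℝ) = β + 1)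
    (hβ : 0 < β) (x : V) : ((L.filter fun C => x ∈ C).card : ℝ) = gauss b D := by
  have h1 := hL.sum_lines (fun _ => 1) x
  have h2 : ∀ C ∈ L.filter (fun C => x ∈ C), ∑ _w ∈ C.erase x, (1 : ℝ) = β := by
    intro C hC
    rw [Finset.mem_filter] at hC
    have h3 := Finset.card_erase_add_one hC.2
    have h4 := hcard C hC.1
    rw [← h3] at h4
    push_cast at h4
    rw [Finset.sum_const, nsmul_eq_mul]
    linarith
  rw [Finset.sum_congr rfl h2, Finset.sum_const, Finset.sum_const, nsmul_eq_mul, nsmul_eq_mul,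
    mul_one, h.degree x] at h1
  exact mul_right_cancel₀ hβ.ne' h1

theorem HasClassicalParams.lineSystem (h : HasClassicalParams G D b α β cc aa bb)
    {L : Finset (Finset V)} (hL : IsCliqueCover G L) (hcard : ∀ C ∈ L, (C.card : ℝ) = β + 1)
    (hb : 2 ≤ b) (hD : 3 ≤ D) (hα : 1 ≤ α ∧ α ≤ (b : ℝ) - 1)
    (hβ : (gauss b D - α - 1) * α * (b : ℝ) + α < β) :
    LineSystem G L (gauss b D) b α β := by
  classical
  have hlt : ∀ i < D, α * gauss b i < β := fun i hi => mul_gauss_lt hb hD hα hβ hi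
  have hβ0 : 0 < β := by simpa [gauss_zero] using hlt 0 (by omega)
  have hβ1 : α < β := by simpa [gauss_one] using hlt 1 (by omega)
  have hβ2 : α * (1 + b) < β := by simpa [gauss_two] using hlt 2 (by omega)
  have hconn := h.1.1
  have hzero : ∀ C ∈ L, ∀ x, ∑ w ∈ C, cosine b α β (G.dist x w) = 0 := fun C hC x =>
    hL.sum_line_eq_zero (h.card_through hL hcard hβ0)
      (h.sum_cosine (by linarith) hlt (by omega) x) hC
  have hcos1 : cosine b α β 1 ≠ 0 := by
    simp only [cosine, gauss_zero]
    simpa using hβ0.ne'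
  have hcos2 : cosine b α β 2 ≠ 0 := by
    have h1 : β - α ≠ 0 := by linarith
    rw [cosine, gauss_one, mul_one]
    exact mul_ne_zero hcos1 (div_ne_zero (by linarith) h1)
  have hnbr : ∀ C ∈ L, ∀ x, x ∉ C → Near G x C →
      ((C.filter fun u => G.Adj x u).card : ℝ) = 1 + α := by
    intro C hC x hx hn
    obtain ⟨c, hc, hxc⟩ := hn.exists_adj hx
    refine card_of_sum_eq_zero (hcard C hC) hcos1 hβ1 hβ0 (fun w _ hw => ?_) (fun w hwC hw => ?_)
      (hzero C hC x)
    · rw [SimpleGraph.dist_eq_one_iff_adj.2 hw]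
    · have h1 : G.dist x w = 2 := by
        have h2 := hconn.dist_triangle (u := x) (v := c) (w := w)
        rw [SimpleGraph.dist_eq_one_iff_adj.2 hxc, SimpleGraph.dist_eq_one_iff_adj.2
          (hL.adj C hC c hc w hwC (by rintro rfl; exact hw hxc))] at h2
        have h3 : 0 < G.dist x w := hconn.pos_dist_of_ne (by rintro rfl; exact hx hwC)
        have h4 : G.dist x w ≠ 1 := fun e => hw (SimpleGraph.dist_eq_one_iff_adj.1 e)
        omega
      rw [h1]
      simp [cosine, gauss_one]
  have htwo : ∀ x y, x ≠ y → ¬ G.Adj x y → (∃ v, G.Adj x v ∧ G.Adj v y) → G.dist x y = 2 := by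
    rintro x y hne hxy ⟨v, hxv, hvy⟩
    have h2 := hconn.dist_triangle (u := x) (v := v) (w := y)
    rw [SimpleGraph.dist_eq_one_iff_adj.2 hxv, SimpleGraph.dist_eq_one_iff_adj.2 hvy] at h2
    have h3 : 0 < G.dist x y := hconn.pos_dist_of_ne hne
    have h4 : G.dist x y ≠ 1 := fun e => hxy (SimpleGraph.dist_eq_one_iff_adj.1 e)
    omega
  refine ⟨hL, hcard, h.card_through hL hcard hβ0, hnbr, ?_, ?_, hα.1, hα.2, ?_, hβ⟩
  · intro C hC x hn
    have hge : ∀ w ∈ C, x ≠ w ∧ ¬ G.Adj x w := fun w hw =>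
      ⟨by rintro rfl; exact hn (near_of_mem hw), fun e => hn (near_of_adj hw e)⟩
    by_cases hex : ∃ q ∈ C, ∃ v, G.Adj x v ∧ G.Adj v q
    · obtain ⟨q, hq, hxq⟩ := hex
      have hq2 := htwo x q (hge q hq).1 (hge q hq).2 hxq
      refine (card_of_sum_eq_zero (hcard C hC) hcos2 hβ2 hβ0 (fun w hwC hw => ?_)
        (fun w hwC hw => ?_) (hzero C hC x)).le
      · rw [htwo x w (hge w hwC).1 (hge w hwC).2 hw]
      · have h1 : G.dist x w = 3 := by
          have h2 := hconn.dist_triangle (u := x) (v := q) (w := w)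
          rw [hq2, SimpleGraph.dist_eq_one_iff_adj.2
            (hL.adj C hC q hq w hwC (by rintro rfl; exact hw hxq))] at h2
          have h3 : 0 < G.dist x w := hconn.pos_dist_of_ne (hge w hwC).1
          have h4 : G.dist x w ≠ 1 := fun e => (hge w hwC).2 (SimpleGraph.dist_eq_one_iff_adj.1 e)
          have h5 : G.dist x w ≠ 2 := by
            intro e
            obtain ⟨p, hp⟩ := hconn.exists_walk_length_eq_dist x w
            rw [e] at hp
            refine hw ⟨p.getVert 1, ?_, ?_⟩
            · simpa using p.adj_getVert_succ (i := 0) (by omega)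
            · have := p.adj_getVert_succ (i := 1) (by omega)
              rwa [show 1 + 1 = p.length by omega, p.getVert_length] at this
          omega
        rw [h1]
        simp [cosine, gauss_two]
    · refine (Nat.cast_eq_zero.2 (Finset.card_eq_zero.2
        (Finset.eq_empty_of_forall_notMem fun q hq => ?_))).le.trans
        (by nlinarith [hα.1, hα.2] : 0 ≤ 1 + α * (1 + (b : ℝ)))
      simp only [Finset.mem_filter] at hq
      exact hex ⟨q, hq⟩
  · intro x y hne hxy hv
    have hd := htwo x y hne hxy hv
    have h1 := hL.sum_lines (fun w => if G.Adj y w then 1 else 0) x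
    have h2 : ∀ C ∈ L.filter (fun C => x ∈ C),
        ∑ w ∈ C.erase x, (if G.Adj y w then (1 : ℝ) else 0) =
          if Near G y C then 1 + α else 0 := by
      intro C hC
      rw [Finset.mem_filter] at hC
      rw [Finset.sum_erase (f := fun w => if G.Adj y w then (1 : ℝ) else 0) _
        (if_neg fun e => hxy e.symm)]
      split_ifs with hn
      · rw [← hnbr C hC.1 y (fun hy => hxy (hL.adj C hC.1 x hC.2 y hy hne)) hn]
        simp
      · refine Finset.sum_eq_zero fun w hw => if_neg fun e => hn (near_of_adj hw e)
    have h3 : ∑ w ∈ Finset.univ.filter (G.Adj x), (if G.Adj y w then (1 : ℝ) else 0) = cc 2 := by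
      rw [← (h.1.2.2.2 2 (by omega) y x (by rwa [SimpleGraph.dist_comm])).1,
        ← Finset.sum_filter, Finset.filter_filter, Finset.sum_const, nsmul_eq_mul, mul_one,
        ← Set.ncard_coe_finset]
      simp
    have h4 := h.2.2 2 (by omega) (by omega)
    rw [show 2 - 1 = 1 from rfl, gauss_one, gauss_two] at h4
    rw [Finset.sum_congr rfl h2, h3, h4, ← Finset.sum_filter, Finset.filter_filter,
      Finset.sum_const, nsmul_eq_mul] at h1
    have h5 : 1 + α ≠ 0 := by linarith [hα.1]
    apply mul_right_cancel₀ h5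
    linear_combination h1
  · have h1 := gauss_mono b hD
    rw [gauss_succ, gauss_two] at h1
    linarith

end Classical

/-- a geometric distance-regular graph with classical parameters
`(D, b, α, β)`, `b ≥ 2`, `1 ≤ α ≤ b - 1`, `D ≥ 3`, line set `𝓒` and `r = [D]` satisfies the
dual Pasch axiom whenever `β > (r - α - 1)αb + α`. -/
theorem statement_14 {V : Type*} [Fintype V] (G : SimpleGraph V) (D b : ℕ) (α β : ℝ)
    (cc aa bb : ℕ → ℕ) (hb : 2 ≤ b) (hD : 3 ≤ D)
    (hα : 1 ≤ α ∧ α ≤ (b : ℝ) - 1)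
    (h : HasClassicalParams G D b α β cc aa bb)
    (𝓒 : Set (Set V)) (hgeo : IsGeomLineSet G (β + 1) 𝓒)
    (hβ : (gauss b D - α - 1) * α * (b : ℝ) + α < β) :
    DualPasch G 𝓒 := by
  classical
  let L : Finset (Finset V) := Finset.univ.filter fun C => (C : Set V) ∈ 𝓒
  have hmem : ∀ C : Finset V, C ∈ L ↔ (C : Set V) ∈ 𝓒 := fun C => by simp [L]
  have hfin : ∀ ℓ ∈ 𝓒, ∃ C ∈ L, (C : Set V) = ℓ := fun ℓ hℓ =>
    ⟨ℓ.toFinset, (hmem _).2 (by simpa using hℓ), by simp⟩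
  have hL : IsCliqueCover G L := by
    refine ⟨fun C hC x hx y hy hxy => ?_, fun x y hxy => ?_,
      fun C hC C' hC' x y hxy h1 h2 h3 h4 => ?_⟩
    · exact (hgeo.1 C ((hmem C).1 hC)).1 hx hy hxy
    · obtain ⟨ℓ, ⟨hℓ, hx, hy⟩, -⟩ := hgeo.2 x y hxy
      obtain ⟨C, hC, rfl⟩ := hfin ℓ hℓ
      exact ⟨C, hC, hx, hy⟩
    · have hC1 := (hmem C).1 hC
      have hadj : G.Adj x y := (hgeo.1 C hC1).1 h1 h2 hxy
      exact Finset.coe_injective ((hgeo.2 x y hadj).unique ⟨hC1, h1, h2⟩ ⟨(hmem C').1 hC', h3, h4⟩)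
  have hcard : ∀ C ∈ L, (C.card : ℝ) = β + 1 := fun C hC => by
    rw [← (hgeo.1 C ((hmem C).1 hC)).2, Set.ncard_coe_finset]
  have hsys := h.lineSystem hL hcard hb hD hα hβ
  intro x y hxy ℓ hℓ hx hy z hz w hw hne
  obtain ⟨C, hC, rfl⟩ := hfin ℓ hℓ
  exact hsys.dual_pasch hC hx hy hxy.ne hz.1 hz.2.1 hz.2.2 hw.1 hw.2.1 hw.2.2 hne
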